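/- arXiv:2604.08013 — 4 statements merged into one kernel-verified Lean document; each statement's English description precedes it below -/
import Mathlib

section
/- There exist a real number δ₋ > 0 and an infinite set M₋ ⊆ ℕ such that for every m ∈ M₋ one has dist(α(m+1/4)², ℤ) ≥ δ₋. -/
noncomputable def G : ℝ := ∑' n : ℕ, Real.sin (((n : ℝ) + 1) * Real.pi / 3) / ((n : ℝ) + 1) ^ 2

noncomputable def alpha : ℝ := 4 * Real.pi ^ 2 / G

/-- The distance from a real number to the nearest integer, `min_{k ∈ ℤ} |x - k|`. -/
noncomputable def distZ (x : ℝ) : ℝ := |x - (round x : ℝ)|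

/-- The sum of the first six terms of the series for `G`. -/
lemma sum_range_six_sin_div_sq :
    ∑ n ∈ Finset.range 6, Real.sin (((n : ℝ) + 1) * Real.pi / 3) / ((n : ℝ) + 1) ^ 2 =
      √3 / 2 * (459 / 400) := by
  have h1 : Real.sin (Real.pi / 3) = √3 / 2 := Real.sin_pi_div_three
  have h2 : Real.sin (2 * Real.pi / 3) = √3 / 2 := by
    rw [show 2 * Real.pi / 3 = Real.pi - Real.pi / 3 by ring, Real.sin_pi_sub, h1]
  have h3 : Real.sin (3 * Real.pi / 3) = 0 := by
    rw [show 3 * Real.pi / 3 = Real.pi by ring, Real.sin_pi]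
  have h4 : Real.sin (4 * Real.pi / 3) = -(√3 / 2) := by
    rw [show 4 * Real.pi / 3 = Real.pi / 3 + Real.pi by ring, Real.sin_add_pi, h1]
  have h5 : Real.sin (5 * Real.pi / 3) = -(√3 / 2) := by
    rw [show 5 * Real.pi / 3 = 2 * Real.pi - Real.pi / 3 by ring, Real.sin_two_pi_sub, h1]
  have h6 : Real.sin (6 * Real.pi / 3) = 0 := by
    rw [show 6 * Real.pi / 3 = 2 * Real.pi by ring, Real.sin_two_pi]
  simp only [Finset.sum_range_succ, Finset.sum_range_zero]
  norm_num [h1, h2, h3, h4, h5, h6]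
  ring

lemma hasSum_one_div_succ_sq :
    HasSum (fun n : ℕ => 1 / ((n : ℝ) + 1) ^ 2) (Real.pi ^ 2 / 6) := by
  simpa using (hasSum_nat_add_iff' 1).mpr hasSum_zeta_two

lemma summable_sin_div_succ_sq :
    Summable fun n : ℕ => Real.sin (((n : ℝ) + 1) * Real.pi / 3) / ((n : ℝ) + 1) ^ 2 := by
  refine Summable.of_norm_bounded hasSum_one_div_succ_sq.summable fun n => ?_
  rw [norm_div, Real.norm_eq_abs, Real.norm_of_nonneg (by positivity : (0 : ℝ) ≤ (n + 1 : ℝ) ^ 2)]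
  gcongr
  exact Real.abs_sin_le_one _

/-- Truncating the series for `G` after six terms costs at most the tail of `ζ(2)`. -/
lemma abs_G_sub_le : |G - √3 / 2 * (459 / 400)| ≤ Real.pi ^ 2 / 6 - 5369 / 3600 := by
  have hs := summable_sin_div_succ_sq.hasSum
  have hz := hasSum_one_div_succ_sq
  have hQ : ∑ n ∈ Finset.range 6, 1 / ((n : ℝ) + 1) ^ 2 = 5369 / 3600 := by
    simp only [Finset.sum_range_succ, Finset.sum_range_zero]
    norm_num
  have hadd := sum_le_hasSum (Finset.range 6) (fun n _ => by
    rw [← add_div]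
    exact div_nonneg (by linarith [Real.neg_one_le_sin (((n : ℝ) + 1) * Real.pi / 3)])
      (by positivity)) (hz.add hs)
  have hsub := sum_le_hasSum (Finset.range 6) (fun n _ => by
    rw [← sub_div]
    exact div_nonneg (by linarith [Real.sin_le_one (((n : ℝ) + 1) * Real.pi / 3)])
      (by positivity)) (hz.sub hs)
  rw [Finset.sum_add_distrib, hQ, sum_range_six_sin_div_sq] at hadd
  rw [Finset.sum_sub_distrib, hQ, sum_range_six_sin_div_sq] at hsub
  rw [abs_le, G]
  constructor <;> linarith

lemma alpha_mem_Ioo : alpha ∈ Set.Ioo (32 : ℝ) 48 := by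
  obtain ⟨hlo, hhi⟩ := abs_le.mp abs_G_sub_le
  have hpi1 := Real.pi_gt_d2
  have hpi2 := Real.pi_lt_d2
  have hsq1 : (9.85 : ℝ) < Real.pi ^ 2 := by nlinarith
  have hsq2 : Real.pi ^ 2 < (9.93 : ℝ) := by nlinarith
  have h3 : (1.73 : ℝ) < √3 := Real.lt_sqrt_of_sq_lt (by norm_num)
  have h3' : √3 < (1.74 : ℝ) := (Real.sqrt_lt' (by norm_num)).mpr (by norm_num)
  have hG : 0 < G := by linarith
  rw [alpha, Set.mem_Ioo, lt_div_iff₀ hG, div_lt_iff₀ hG]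
  constructor <;> linarith

lemma distZ_eq_zero_iff {x : ℝ} : distZ x = 0 ↔ ∃ k : ℤ, x = k := by
  constructor
  · intro h
    exact ⟨round x, sub_eq_zero.mp (abs_eq_zero.mp h)⟩
  · rintro ⟨k, rfl⟩
    simp [distZ]

lemma distZ_le (x : ℝ) (k : ℤ) : distZ x ≤ |x - k| := round_le x k

/-- The second difference of a function is close to an integer where its values are. -/
lemma distZ_second_difference_le (x y z : ℝ) :
    distZ (z - 2 * y + x) ≤ distZ z + 2 * distZ y + distZ x := by
  have h := distZ_le (z - 2 * y + x) (round z - 2 * round y + round x)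
  refine h.trans ?_
  push_cast
  unfold distZ
  rw [abs_le]
  constructor <;>
    linarith [neg_abs_le (x - round x), le_abs_self (x - round x), neg_abs_le (y - round y),
      le_abs_self (y - round y), neg_abs_le (z - round z), le_abs_self (z - round z)]

/-- If `α (m + 1/4)²` tends to `0` modulo `1`, then `α` is an integer multiple of `16`. -/
lemma exists_eq_sixteen_mul_of_eventually_distZ_lt {a : ℝ}
    (h : ∀ δ : ℝ, 0 < δ → ∀ᶠ m : ℕ in Filter.atTop, distZ (a * ((m : ℝ) + 1 / 4) ^ 2) < δ) :
    ∃ j : ℤ, a = 16 * j := by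
  have hzero : distZ (2 * a) = 0 := by
    refine le_antisymm (le_of_forall_pos_le_add fun ε hε => ?_) (abs_nonneg _)
    obtain ⟨N, hN⟩ := Filter.eventually_atTop.mp (h (ε / 4) (by positivity))
    have key := distZ_second_difference_le (a * ((N : ℝ) + 1 / 4) ^ 2)
      (a * (((N + 1 : ℕ) : ℝ) + 1 / 4) ^ 2) (a * (((N + 2 : ℕ) : ℝ) + 1 / 4) ^ 2)
    rw [show a * (((N + 2 : ℕ) : ℝ) + 1 / 4) ^ 2 - 2 * (a * (((N + 1 : ℕ) : ℝ) + 1 / 4) ^ 2)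
      + a * ((N : ℝ) + 1 / 4) ^ 2 = 2 * a by push_cast; ring] at key
    linarith [hN N le_rfl, hN (N + 1) (by omega), hN (N + 2) (by omega)]
  obtain ⟨k, hk⟩ := distZ_eq_zero_iff.mp hzero
  obtain ⟨m, hm⟩ := (h (1 / 32) (by norm_num)).exists
  rw [show a * ((m : ℝ) + 1 / 4) ^ 2 = k * (4 * m + 1) ^ 2 / 32 by
    rw [← hk]; ring, distZ] at hm
  set r := round ((k : ℝ) * (4 * m + 1) ^ 2 / 32)
  have hlt : |k * (4 * m + 1) ^ 2 - 32 * r| < 1 := by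
    obtain ⟨h1, h2⟩ := abs_lt.mp hm
    have : |((k * (4 * m + 1) ^ 2 - 32 * r : ℤ) : ℝ)| < 1 := by
      push_cast
      rw [abs_lt]
      constructor <;> linarith
    exact_mod_cast this
  have hdvd : (32 : ℤ) ∣ k * (4 * m + 1) ^ 2 :=
    ⟨r, sub_eq_zero.mp (Int.abs_lt_one_iff.mp hlt)⟩
  have hcop : IsCoprime (32 : ℤ) ((4 * m + 1) ^ 2) := by
    have : IsCoprime (2 : ℤ) (4 * m + 1) := ⟨-(2 * m), 1, by ring⟩
    exact (this.pow (m := 5) (n := 2))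
  obtain ⟨j, hj⟩ := hcop.dvd_of_dvd_mul_right hdvd
  refine ⟨j, ?_⟩
  rw [hj] at hk
  push_cast at hk
  linarith

theorem good_minus_subsequence :
    ∃ δ : ℝ, 0 < δ ∧ ∃ M : Set ℕ, M.Infinite ∧
      ∀ m ∈ M, δ ≤ distZ (alpha * ((m : ℝ) + 1 / 4) ^ 2) := by
  by_contra hne
  obtain ⟨j, hj⟩ := exists_eq_sixteen_mul_of_eventually_distZ_lt (a := alpha) fun δ hδ => by
    by_contra hev
    refine hne ⟨δ, hδ, {m : ℕ | δ ≤ distZ (alpha * ((m : ℝ) + 1 / 4) ^ 2)}, ?_, fun m hm => hm⟩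
    rw [← Nat.frequently_atTop_iff_infinite]
    simpa only [Filter.not_eventually, not_lt] using hev
  obtain ⟨hlo, hhi⟩ := alpha_mem_Ioo
  rw [hj] at hlo hhi
  have h1 : (32 : ℤ) < 16 * j := by exact_mod_cast hlo
  have h2 : 16 * j < (48 : ℤ) := by exact_mod_cast hhi
  omega
end

section
/- The real number α := 4π²/G is not an integer. -/
open Filter Finset Topology

lemma sin_six_mul_add_mul_pi_div_three (N : ℕ) (x : ℝ) :
    Real.sin ((6 * N + x) * Real.pi / 3) = Real.sin (x * Real.pi / 3) := by
  rw [← Real.sin_add_nat_mul_two_pi (x * Real.pi / 3) N]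
  congr 1
  ring

lemma sin_two_mul_pi_div_three : Real.sin (2 * Real.pi / 3) = √3 / 2 := by
  rw [← Real.sin_pi_div_three, ← Real.sin_pi_sub]
  congr 1
  ring

lemma sin_four_mul_pi_div_three : Real.sin (4 * Real.pi / 3) = -(√3 / 2) := by
  rw [← Real.sin_pi_div_three, ← Real.sin_add_pi]
  congr 1
  ring

lemma sin_five_mul_pi_div_three : Real.sin (5 * Real.pi / 3) = -(√3 / 2) := by
  rw [← sin_two_mul_pi_div_three, ← Real.sin_add_pi]
  congr 1
  ring

/-- The sum of the terms `6 k + 1, …, 6 k + 6` of the series for `G`, divided by `√3 / 2`. -/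
noncomputable def blockSum (k : ℕ) : ℝ :=
  1 / (6 * k + 1) ^ 2 + 1 / (6 * k + 2) ^ 2 - 1 / (6 * k + 4) ^ 2 - 1 / (6 * k + 5) ^ 2

/-- The partial sums of the series for `G`. -/
noncomputable def partialSum (m : ℕ) : ℝ :=
  ∑ n ∈ range m, Real.sin (((n : ℝ) + 1) * Real.pi / 3) / ((n : ℝ) + 1) ^ 2

lemma tendsto_partialSum : Tendsto partialSum atTop (𝓝 G) := by
  refine (Summable.hasSum ?_).tendsto_sum_nat
  have h : Summable fun n : ℕ => 1 / ((n : ℝ) + 1) ^ 2 := by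
    have := (summable_nat_add_iff 1).2 (Real.summable_one_div_nat_pow.2 one_lt_two)
    simpa using this
  refine h.of_norm_bounded fun n => ?_
  rw [Real.norm_eq_abs, abs_div, abs_of_nonneg (by positivity : (0 : ℝ) ≤ ((n : ℝ) + 1) ^ 2)]
  gcongr
  exact Real.abs_sin_le_one _

lemma partialSum_six_mul_add_three (N : ℕ) :
    partialSum (6 * N + 3) =
      partialSum (6 * N) + √3 / 2 * (1 / (6 * N + 1) ^ 2 + 1 / (6 * N + 2) ^ 2) := by
  have h1 := sin_six_mul_add_mul_pi_div_three N 1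
  have h2 := sin_six_mul_add_mul_pi_div_three N 2
  have h3 := sin_six_mul_add_mul_pi_div_three N 3
  rw [one_mul, Real.sin_pi_div_three] at h1
  rw [sin_two_mul_pi_div_three] at h2
  rw [mul_div_cancel_left₀ _ (by norm_num : (3 : ℝ) ≠ 0), Real.sin_pi] at h3
  simp only [partialSum, sum_range_succ, Nat.cast_add, Nat.cast_mul, Nat.cast_ofNat, Nat.cast_one,
    add_assoc]
  norm_num [h1, h2, h3]
  ring

lemma partialSum_six_mul_succ (N : ℕ) :
    partialSum (6 * (N + 1)) =
      partialSum (6 * N + 3) - √3 / 2 * (1 / (6 * N + 4) ^ 2 + 1 / (6 * N + 5) ^ 2) := by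
  have h4 := sin_six_mul_add_mul_pi_div_three N 4
  have h5 := sin_six_mul_add_mul_pi_div_three N 5
  have h6 := sin_six_mul_add_mul_pi_div_three N 6
  rw [sin_four_mul_pi_div_three] at h4
  rw [sin_five_mul_pi_div_three] at h5
  rw [show (6 : ℝ) * Real.pi / 3 = 2 * Real.pi by ring, Real.sin_two_pi] at h6
  rw [show 6 * (N + 1) = 6 * N + 6 by ring]
  simp only [partialSum, sum_range_succ, Nat.cast_add, Nat.cast_mul, Nat.cast_ofNat, Nat.cast_one,
    add_assoc]
  norm_num [h4, h5, h6]
  ring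

lemma partialSum_six_mul (N : ℕ) :
    partialSum (6 * N) = √3 / 2 * ∑ k ∈ range N, blockSum k := by
  induction N with
  | zero => simp [partialSum]
  | succ N ih =>
    rw [partialSum_six_mul_succ, partialSum_six_mul_add_three, ih, sum_range_succ, blockSum]
    ring

lemma partialSum_six_mul_le (N : ℕ) : partialSum (6 * N) ≤ G := by
  have hmono : Monotone fun N => partialSum (6 * N) := by
    refine monotone_nat_of_le_succ fun N => ?_
    rw [partialSum_six_mul_succ, partialSum_six_mul_add_three, add_sub_assoc, ← mul_sub]
    refine le_add_of_nonneg_right (mul_nonneg (by positivity) (sub_nonneg.2 ?_))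
    gcongr <;> norm_num
  exact hmono.ge_of_tendsto
    (tendsto_partialSum.comp (tendsto_atTop_mono (fun n => show n ≤ _ by lia) tendsto_id)) N

lemma le_partialSum_six_mul_add_three (N : ℕ) : G ≤ partialSum (6 * N + 3) := by
  have hanti : Antitone fun N => partialSum (6 * N + 3) := by
    refine antitone_nat_of_succ_le fun N => ?_
    rw [partialSum_six_mul_add_three, partialSum_six_mul_succ, sub_add, ← mul_sub]
    refine sub_le_self _ (mul_nonneg (by positivity) (sub_nonneg.2 ?_))
    push_cast
    rw [mul_add]
    gcongr ?_ + ?_ <;> gcongr 1 / ?_ ^ 2 <;> linarith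
  exact hanti.le_of_tendsto
    (tendsto_partialSum.comp (tendsto_atTop_mono (fun n => show n ≤ _ by lia) tendsto_id)) N

lemma lt_G : 1.0124 < G := by
  have h := partialSum_six_mul_le 5
  have h3 : (1.732 : ℝ) < √3 := Real.lt_sqrt_of_sq_lt (by norm_num)
  have hs : (1.1691 : ℝ) < ∑ k ∈ range 5, blockSum k := by
    norm_num [sum_range_succ, blockSum]
  rw [partialSum_six_mul] at h
  nlinarith

lemma G_lt : G < 1.03 := by
  have h := le_partialSum_six_mul_add_three 1
  have h3 : √3 < 1.733 := (Real.sqrt_lt' (by norm_num)).2 (by norm_num)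
  rw [partialSum_six_mul_add_three, partialSum_six_mul] at h
  norm_num [blockSum] at h
  linarith

theorem alpha_not_integer : ∀ k : ℤ, alpha ≠ (k : ℝ) := by
  intro k hk
  have hG := lt_G
  have hG' := G_lt
  have hpos : 0 < G := by linarith
  have hpi := Real.pi_gt_d4
  have hpi' := Real.pi_lt_d4
  have hlow : (38 : ℝ) < alpha := by
    rw [alpha, lt_div_iff₀ hpos]
    nlinarith
  have hupp : alpha < 39 := by
    rw [alpha, div_lt_iff₀ hpos]
    nlinarith
  rw [hk] at hlow hupp
  have h1 : 38 < k := by exact_mod_cast hlow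
  have h2 : k < 39 := by exact_mod_cast hupp
  lia
end

section
/- One has the bounds 1.0147430670 < G < 1.0149758071. -/
/-- The general term of the series defining `G`. -/
noncomputable def gTerm (n : ℕ) : ℝ := Real.sin (((n : ℝ) + 1) * Real.pi / 3) / ((n : ℝ) + 1) ^ 2

/-- The sum of six consecutive terms of the series, up to the factor `√3 / 2`. -/
noncomputable def gBlock (x : ℝ) : ℝ :=
  1 / (6 * x + 1) ^ 2 + 1 / (6 * x + 2) ^ 2 - 1 / (6 * x + 4) ^ 2 - 1 / (6 * x + 5) ^ 2

lemma summable_gTerm : Summable gTerm := by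
  have h : Summable fun n : ℕ => 1 / ((n : ℝ) + 1) ^ 2 := by
    have := (summable_nat_add_iff 1).2 (Real.summable_one_div_nat_pow.2 one_lt_two)
    simpa using this
  refine Summable.of_norm_bounded h fun n => ?_
  rw [gTerm, norm_div, Real.norm_eq_abs, Real.norm_eq_abs,
    abs_of_pos (by positivity : (0 : ℝ) < ((n : ℝ) + 1) ^ 2)]
  gcongr
  exact Real.abs_sin_le_one _

lemma sin_six_mul_add (k : ℕ) (j : ℝ) :
    Real.sin ((6 * k + j) * Real.pi / 3) = Real.sin (j * Real.pi / 3) := by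
  rw [← Real.sin_add_nat_mul_two_pi (j * Real.pi / 3) k]
  congr 1
  ring

lemma sum_range_six_mul_succ (k : ℕ) :
    ∑ n ∈ Finset.range (6 * (k + 1)), gTerm n =
      ∑ n ∈ Finset.range (6 * k), gTerm n + √3 / 2 * gBlock k := by
  have h1 : Real.sin (1 * Real.pi / 3) = √3 / 2 := by rw [one_mul, Real.sin_pi_div_three]
  have h2 : Real.sin (2 * Real.pi / 3) = √3 / 2 := by
    rw [← Real.sin_pi_div_three, ← Real.sin_pi_sub]; congr 1; ring
  have h3 : Real.sin (3 * Real.pi / 3) = 0 := by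
    rw [← Real.sin_pi]; congr 1; ring
  have h4 : Real.sin (4 * Real.pi / 3) = -(√3 / 2) := by
    rw [← Real.sin_pi_div_three, ← Real.sin_add_pi]; congr 1; ring
  have h5 : Real.sin (5 * Real.pi / 3) = -(√3 / 2) := by
    rw [← Real.sin_pi_div_three, ← Real.sin_two_pi_sub]; congr 1; ring
  have h6 : Real.sin (6 * Real.pi / 3) = 0 := by
    rw [← Real.sin_two_pi]; congr 1; ring
  have e (j i : ℕ) (hj : i + 1 = j) :
      gTerm (6 * k + i) = Real.sin ((j : ℝ) * Real.pi / 3) / (6 * (k : ℝ) + j) ^ 2 := by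
    rw [gTerm, ← sin_six_mul_add k j, ← hj]
    push_cast
    simp only [add_assoc]
  have e1 := e 1 0 rfl
  have e2 := e 2 1 rfl
  have e3 := e 3 2 rfl
  have e4 := e 4 3 rfl
  have e5 := e 5 4 rfl
  have e6 := e 6 5 rfl
  push_cast at e1 e2 e3 e4 e5 e6
  rw [mul_add, Finset.sum_range_add]
  simp only [Nat.mul_one, Finset.sum_range_succ, Finset.sum_range_zero, e1, e2, e3, e4, e5, e6,
    h1, h2, h3, h4, h5, h6, gBlock]
  ring

lemma gBlock_le {y : ℝ} (hy : 0 ≤ y) :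
    gBlock (y + 3) ≤ 1 / (36 * (y + 3) ^ 2 + 5) - 1 / (36 * (y + 4) ^ 2 + 5) := by
  rw [gBlock, ← sub_nonneg]
  field_simp
  ring_nf
  positivity

lemma le_gBlock {y : ℝ} (hy : 0 ≤ y) :
    1 / (36 * (y + 3) ^ 2 + 6) - 1 / (36 * (y + 4) ^ 2 + 6) ≤ gBlock (y + 3) := by
  rw [gBlock, ← sub_nonneg]
  field_simp
  ring_nf
  positivity

lemma sum_range_bounds (m : ℕ) :
    √3 / 2 * (gBlock 0 + gBlock 1 + gBlock 2 + 1 / 330 - 1 / (36 * ((m : ℝ) + 3) ^ 2 + 6)) ≤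
        ∑ n ∈ Finset.range (6 * (m + 3)), gTerm n ∧
      ∑ n ∈ Finset.range (6 * (m + 3)), gTerm n ≤
        √3 / 2 * (gBlock 0 + gBlock 1 + gBlock 2 + 1 / 329 -
          1 / (36 * ((m : ℝ) + 3) ^ 2 + 5)) := by
  have hs : 0 ≤ √3 / 2 := by positivity
  induction m with
  | zero =>
    rw [sum_range_six_mul_succ, sum_range_six_mul_succ, sum_range_six_mul_succ]
    norm_num
    constructor <;> apply le_of_eq <;> ring
  | succ m ih =>
    have hm : (0 : ℝ) ≤ m := m.cast_nonneg
    have hu := mul_le_mul_of_nonneg_left (gBlock_le hm) hs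
    have hl := mul_le_mul_of_nonneg_left (le_gBlock hm) hs
    rw [show m + 1 + 3 = (m + 3) + 1 by ring, sum_range_six_mul_succ]
    push_cast
    rw [show (m : ℝ) + 1 + 3 = m + 4 by ring]
    constructor <;> linarith [ih.1, ih.2]

theorem G_bounds : 1.0147430670 < G ∧ G < 1.0149758071 := by
  have ht : Filter.Tendsto (fun m : ℕ => ∑ n ∈ Finset.range (6 * (m + 3)), gTerm n)
      Filter.atTop (nhds G) :=
    summable_gTerm.hasSum.tendsto_sum_nat.comp
      (Filter.tendsto_atTop_mono (fun m => (by lia : m ≤ 6 * (m + 3))) Filter.tendsto_id)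
  have hs1 : (1.73205 : ℝ) < √3 := Real.lt_sqrt_of_sq_lt (by norm_num)
  have hs2 : √3 < 1.73206 := (Real.sqrt_lt' (by norm_num)).2 (by norm_num)
  constructor
  · have h : √3 / 2 * (gBlock 0 + gBlock 1 + gBlock 2 + 1 / 330 - 1 / 360000) ≤ G := by
      refine ge_of_tendsto ht ?_
      filter_upwards [Filter.eventually_ge_atTop 100] with m hm
      refine le_trans ?_ (sum_range_bounds m).1
      have hm' : (100 : ℝ) ≤ m := by exact_mod_cast hm
      gcongr
      nlinarith
    refine lt_of_lt_of_le ?_ h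
    norm_num [gBlock] at hs1 ⊢
    linarith
  · have h : G ≤ √3 / 2 * (gBlock 0 + gBlock 1 + gBlock 2 + 1 / 329) := by
      refine le_of_tendsto' ht fun m => (sum_range_bounds m).2.trans ?_
      gcongr
      exact sub_le_self _ (by positivity)
    refine lt_of_le_of_lt h ?_
    norm_num [gBlock] at hs2 ⊢
    linarith
end

section
/- One has the bounds 38.8959 < 4π²/G < 38.9049. -/
open Filter Topology

/-- The sum of the coefficients of `√3 / 2` in the `k`-th block of six terms of `G`. -/
noncomputable def clausenBlock (k : ℕ) : ℝ :=
  1 / (6 * (k : ℝ) + 1) ^ 2 + 1 / (6 * (k : ℝ) + 2) ^ 2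
    - 1 / (6 * (k : ℝ) + 4) ^ 2 - 1 / (6 * (k : ℝ) + 5) ^ 2

lemma clausenBlock_nonneg (k : ℕ) : 0 ≤ clausenBlock k := by
  have h₁ : 1 / (6 * (k : ℝ) + 4) ^ 2 ≤ 1 / (6 * (k : ℝ) + 1) ^ 2 := by gcongr; norm_num
  have h₂ : 1 / (6 * (k : ℝ) + 5) ^ 2 ≤ 1 / (6 * (k : ℝ) + 2) ^ 2 := by gcongr; norm_num
  unfold clausenBlock
  linarith

lemma clausenBlock_le {k : ℕ} (hk : 0 < k) :
    clausenBlock k ≤ 1 / (6 * (k : ℝ)) ^ 2 - 1 / (6 * ((k + 1 : ℕ) : ℝ)) ^ 2 := by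
  have hk' : (0 : ℝ) < k := by exact_mod_cast hk
  unfold clausenBlock
  push_cast
  rw [← sub_nonneg]
  generalize (k : ℝ) = x at hk'
  have h : 1 / (6 * x) ^ 2 - 1 / (6 * (x + 1)) ^ 2
      - (1 / (6 * x + 1) ^ 2 + 1 / (6 * x + 2) ^ 2 - 1 / (6 * x + 4) ^ 2 - 1 / (6 * x + 5) ^ 2)
      = 12 * (6 * x + 3) * (1 / (6 * x * (6 * x + 6)) ^ 2
        - 1 / 3 * (1 / ((6 * x + 1) * (6 * x + 5)) ^ 2 * 2 + 1 / ((6 * x + 2) * (6 * x + 4)) ^ 2)) := by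
    field_simp
    ring
  have h₁ : 1 / ((6 * x + 1) * (6 * x + 5)) ^ 2 ≤ 1 / (6 * x * (6 * x + 6)) ^ 2 :=
    one_div_le_one_div_of_le (by positivity) (pow_le_pow_left₀ (by positivity) (by nlinarith) 2)
  have h₂ : 1 / ((6 * x + 2) * (6 * x + 4)) ^ 2 ≤ 1 / (6 * x * (6 * x + 6)) ^ 2 :=
    one_div_le_one_div_of_le (by positivity) (pow_le_pow_left₀ (by positivity) (by nlinarith) 2)
  rw [h]
  exact mul_nonneg (by positivity) (by linarith)

lemma sum_range_six_mul (K : ℕ) :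
    ∑ n ∈ Finset.range (6 * K), Real.sin (((n : ℝ) + 1) * Real.pi / 3) / ((n : ℝ) + 1) ^ 2
      = √3 / 2 * ∑ k ∈ Finset.range K, clausenBlock k := by
  induction K with
  | zero => simp
  | succ K ih =>
    have h₁ : Real.sin (((6 * K : ℝ) + 1) * Real.pi / 3) = √3 / 2 := by
      rw [show ((6 * K : ℝ) + 1) * Real.pi / 3 = Real.pi / 3 + K * (2 * Real.pi) by ring,
        Real.sin_add_nat_mul_two_pi, Real.sin_pi_div_three]
    have h₂ : Real.sin (((6 * K : ℝ) + 1 + 1) * Real.pi / 3) = √3 / 2 := by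
      rw [show ((6 * K : ℝ) + 1 + 1) * Real.pi / 3
          = (Real.pi - Real.pi / 3) + K * (2 * Real.pi) by ring,
        Real.sin_add_nat_mul_two_pi, Real.sin_pi_sub, Real.sin_pi_div_three]
    have h₃ : Real.sin (((6 * K : ℝ) + 2 + 1) * Real.pi / 3) = 0 := by
      rw [show ((6 * K : ℝ) + 2 + 1) * Real.pi / 3 = Real.pi + K * (2 * Real.pi) by ring,
        Real.sin_add_nat_mul_two_pi, Real.sin_pi]
    have h₄ : Real.sin (((6 * K : ℝ) + 3 + 1) * Real.pi / 3) = -(√3 / 2) := by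
      rw [show ((6 * K : ℝ) + 3 + 1) * Real.pi / 3
          = (Real.pi / 3 + Real.pi) + K * (2 * Real.pi) by ring,
        Real.sin_add_nat_mul_two_pi, Real.sin_add_pi, Real.sin_pi_div_three]
    have h₅ : Real.sin (((6 * K : ℝ) + 4 + 1) * Real.pi / 3) = -(√3 / 2) := by
      rw [show ((6 * K : ℝ) + 4 + 1) * Real.pi / 3
          = -(Real.pi / 3) + ((K + 1 : ℕ) : ℝ) * (2 * Real.pi) by push_cast; ring,
        Real.sin_add_nat_mul_two_pi, Real.sin_neg, Real.sin_pi_div_three]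
    have h₆ : Real.sin (((6 * K : ℝ) + 5 + 1) * Real.pi / 3) = 0 := by
      rw [show ((6 * K : ℝ) + 5 + 1) * Real.pi / 3
          = 0 + ((K + 1 : ℕ) : ℝ) * (2 * Real.pi) by push_cast; ring,
        Real.sin_add_nat_mul_two_pi, Real.sin_zero]
    rw [show 6 * (K + 1) = 6 * K + 1 + 1 + 1 + 1 + 1 + 1 by ring]
    simp only [Finset.sum_range_succ, ih, mul_add, add_assoc, Nat.reduceAdd]
    push_cast
    rw [h₁, h₂, h₃, h₄, h₅, h₆, clausenBlock]
    ring

lemma tendsto_sum_clausenBlock :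
    Tendsto (fun K : ℕ => √3 / 2 * ∑ k ∈ Finset.range K, clausenBlock k) atTop (𝓝 G) := by
  have hs : Summable fun n : ℕ =>
      Real.sin (((n : ℝ) + 1) * Real.pi / 3) / ((n : ℝ) + 1) ^ 2 := by
    have h := (summable_nat_add_iff 1).mpr (Real.summable_one_div_nat_pow.mpr one_lt_two)
    refine Summable.of_norm_bounded h fun n => ?_
    rw [Real.norm_eq_abs, abs_div, abs_of_nonneg (by positivity : (0 : ℝ) ≤ ((n : ℝ) + 1) ^ 2)]
    push_cast
    gcongr
    exact Real.abs_sin_le_one _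
  have ht := hs.hasSum.tendsto_sum_nat.comp
    (tendsto_id.const_mul_atTop' (show 0 < 6 by norm_num))
  exact ht.congr sum_range_six_mul

lemma le_G (K : ℕ) : √3 / 2 * ∑ k ∈ Finset.range K, clausenBlock k ≤ G := by
  refine ge_of_tendsto tendsto_sum_clausenBlock ?_
  filter_upwards [eventually_ge_atTop K] with n hn
  gcongr
  exact fun _ _ _ => clausenBlock_nonneg _

lemma G_le {K : ℕ} (hK : 0 < K) :
    G ≤ √3 / 2 * (∑ k ∈ Finset.range K, clausenBlock k + 1 / (6 * (K : ℝ)) ^ 2) := by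
  refine le_of_tendsto tendsto_sum_clausenBlock ?_
  filter_upwards [eventually_ge_atTop K] with n hn
  gcongr
  suffices h : ∑ k ∈ Finset.range n, clausenBlock k + 1 / (6 * (n : ℝ)) ^ 2
      ≤ ∑ k ∈ Finset.range K, clausenBlock k + 1 / (6 * (K : ℝ)) ^ 2 from
    le_trans (le_add_of_nonneg_right (by positivity)) h
  induction n, hn using Nat.le_induction with
  | base => exact le_rfl
  | succ n hn ih =>
    rw [Finset.sum_range_succ]
    linarith [clausenBlock_le (hK.trans_le hn)]

theorem alpha_bounds : 38.8959 < 4 * Real.pi ^ 2 / G ∧ 4 * Real.pi ^ 2 / G < 38.9049 := by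
  have h3l : 1.73205 < √3 := Real.lt_sqrt_of_sq_lt (by norm_num)
  have h3u : √3 < 1.732051 := by rw [Real.sqrt_lt' (by norm_num)]; norm_num
  have hSl : 1.17175 < ∑ k ∈ Finset.range 12, clausenBlock k := by
    norm_num [Finset.sum_range_succ, clausenBlock]
  have hSu : ∑ k ∈ Finset.range 12, clausenBlock k + 1 / (6 * ((12 : ℕ) : ℝ)) ^ 2 < 1.17196 := by
    norm_num [Finset.sum_range_succ, clausenBlock]
  have hl : 1.01476 < G := by
    refine lt_of_lt_of_le ?_ (le_G 12)
    nlinarith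
  have hu : G < 1.01495 := by
    refine lt_of_le_of_lt (G_le (K := 12) (by norm_num)) ?_
    nlinarith
  have hpl := Real.pi_gt_d6
  have hpu := Real.pi_lt_d6
  have hG : 0 < G := by linarith
  rw [lt_div_iff₀ hG, div_lt_iff₀ hG]
  constructor <;> nlinarith
end
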